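/- If a group Γ of affine transformations of 𝕋^d acts ergodically (with respect to Lebesgue measure), then every finite-index subgroup Γ₀ of Γ also acts ergodically on 𝕋^d. -/

import Mathlib

open MeasureTheory Matrix

/-- The `d`-dimensional torus `𝕋^d = ℝ^d/ℤ^d`. -/
abbrev Torus (d : ℕ) := Fin d → AddCircle (1 : ℝ)

/-- The affine transformation `x ↦ α + τ x` of the torus, where `τ ∈ GL(d,ℤ)`. -/
noncomputable def affAct {d : ℕ} (α : Torus d) (τ : Matrix (Fin d) (Fin d) ℤ)
    (x : Torus d) : Torus d :=
  fun i => α i + ∑ j, τ i j • x j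

lemma aux_int_zero {d : ℕ} (h : Torus d → ℂ) (κ : Torus d → ℂ)
    (hh : ∀ a x, h (a + x) = κ a * h x) (a : Torus d) (ha : κ a ≠ 1) : ∫ x, h x = 0 := by
  have h1 : ∫ x, h (a + x) = ∫ x, h x := integral_add_left_eq_self h a
  simp only [hh] at h1
  rw [integral_const_mul] at h1
  have h2 : (κ a - 1) * ∫ x, h x = 0 := by rw [sub_mul, h1]; ring
  exact (mul_eq_zero.mp h2).resolve_left (sub_ne_zero.mpr ha)

lemma aux_mFourier_add {d : ℕ} (n : Fin d → ℤ) (x y : Torus d) :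
    UnitAddTorus.mFourier n (x + y) = UnitAddTorus.mFourier n x * UnitAddTorus.mFourier n y := by
  simp [UnitAddTorus.mFourier, fourier_apply, Finset.prod_mul_distrib, AddCircle.toCircle_add]

lemma aux_mFourier_norm {d : ℕ} (n : Fin d → ℤ) (x : Torus d) :
    ‖UnitAddTorus.mFourier n x‖ = 1 := by
  simp only [UnitAddTorus.mFourier, fourier_apply, ContinuousMap.coe_mk, norm_prod,
    Circle.norm_coe, Finset.prod_const_one]

instance aux_prob {d : ℕ} : IsProbabilityMeasure (volume : Measure (Torus d)) := by
  have : IsProbabilityMeasure (volume : Measure (AddCircle (1:ℝ))) := ⟨by simp⟩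
  infer_instance

lemma aux_complete {d : ℕ} (s : Set (Torus d)) (hs : MeasurableSet s)
    (h : ∀ n : Fin d → ℤ, ∫ x in s, UnitAddTorus.mFourier n x = 0 ∨
      ∀ x, UnitAddTorus.mFourier n x = 1) :
    volume s = 0 ∨ volume s = 1 := by
  set μ : Measure (Torus d) := volume with hμ
  let f := indicatorConstLp 2 hs (measure_ne_top μ s) (1 : ℂ)
  let e := indicatorConstLp 2 MeasurableSet.univ (measure_ne_top μ Set.univ) (1 : ℂ)
  let g := f - (μ.real s : ℂ) • e
  have hspan : (Submodule.span ℂ (Set.range fun n : Fin d → ℤ =>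
      ContinuousMap.toLp (E := ℂ) 2 μ ℂ (UnitAddTorus.mFourier n))).topologicalClosure = ⊤ := by
    simpa only [Submodule.map_span, ContinuousLinearMap.coe_coe, ← Set.range_comp,
      Function.comp_def] using
      (ContinuousMap.toLp_denseRange ℂ μ ℂ (by simp : (2 : ENNReal) ≠ ⊤)).topologicalClosure_map_submodule
        (UnitAddTorus.span_mFourier_closure_eq_top (d := Fin d))
  rw [Submodule.topologicalClosure_eq_top_iff] at hspan
  have hint : ∀ (t : Set (Torus d)) (n : Fin d → ℤ),
      ∫ x in t, (ContinuousMap.toLp (E := ℂ) 2 μ ℂ (UnitAddTorus.mFourier n)) x ∂μ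
        = ∫ x in t, UnitAddTorus.mFourier n x ∂μ := fun t n =>
    integral_congr_ae (ae_restrict_of_ae (ContinuousMap.coeFn_toLp μ _))
  have hg : g = 0 := by
    rw [← Submodule.mem_bot (R := ℂ), ← hspan, Submodule.mem_orthogonal']
    intro u hu
    induction hu using Submodule.span_induction with
    | zero => simp
    | add x y _ _ hx hy => rw [inner_add_right, hx, hy, add_zero]
    | smul a x _ hx => rw [inner_smul_right, hx, mul_zero]
    | mem x hx =>
      obtain ⟨n, rfl⟩ := hx
      simp only [g, f, e, inner_sub_left, inner_smul_left, L2.inner_indicatorConstLp_one, hint]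
      by_cases hc : ∀ x, UnitAddTorus.mFourier n x = 1
      · simp [hc]
      · rw [(h n).resolve_right hc]
        push Not at hc
        obtain ⟨a, ha⟩ := hc
        rw [Measure.restrict_univ, aux_int_zero _ _ (aux_mFourier_add n) a ha]
        simp
  have h2 : inner ℂ g f = 0 := by rw [hg, inner_zero_left]
  simp only [g, f, e, inner_sub_left, inner_smul_left,
    L2.inner_indicatorConstLp_one_indicatorConstLp_one, Set.univ_inter, Set.inter_self,
    Complex.conj_ofReal] at h2
  have h3 : μ.real s * (1 - μ.real s) = 0 := by
    have : μ.real s - μ.real s * μ.real s = 0 := by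
      apply Complex.ofReal_injective
      rw [Complex.ofReal_sub, Complex.ofReal_mul, Complex.ofReal_zero]
      exact h2
    linarith
  rcases mul_eq_zero.mp h3 with h4 | h4
  · left
    exact (measureReal_eq_zero_iff).mp h4
  · right
    have h5 : μ.real s = 1 := by linarith
    rw [← ofReal_measureReal (μ := μ) (s := s), h5, ENNReal.ofReal_one]

/-- linear part -/
noncomputable def linPart {d : ℕ} (τ : Matrix (Fin d) (Fin d) ℤ) : Torus d →+ Torus d where
  toFun x := fun i => ∑ j, τ i j • x j
  map_zero' := by ext; simp
  map_add' x y := by ext; simp [Finset.sum_add_distrib]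

lemma aff_eq {d : ℕ} (α : Torus d) (τ : Matrix (Fin d) (Fin d) ℤ) (x : Torus d) :
    affAct α τ x = α + linPart τ x := rfl

lemma lin_cont {d : ℕ} (τ : Matrix (Fin d) (Fin d) ℤ) : Continuous (linPart τ) := by
  change Continuous (fun (x : Torus d) => fun i => ∑ j, τ i j • x j)
  fun_prop

lemma aff_cont {d : ℕ} (α : Torus d) (τ : Matrix (Fin d) (Fin d) ℤ) :
    Continuous (affAct α τ) := continuous_const.add (lin_cont τ)

lemma aff_mp {d : ℕ} (α : Torus d) (τ : Matrix (Fin d) (Fin d) ℤ)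
    (h : Function.Surjective (affAct α τ)) : MeasurePreserving (affAct α τ) volume volume := by
  have hs : Function.Surjective (linPart τ) := by
    intro y
    obtain ⟨x, hx⟩ := h (α + y)
    exact ⟨x, add_left_cancel hx⟩
  have h1 : MeasurePreserving (linPart τ) volume volume :=
    AddMonoidHom.measurePreserving (lin_cont τ) hs rfl
  exact (measurePreserving_add_left volume α).comp h1

lemma aux_bessel {d : ℕ} (s : Set (Torus d)) (hs : MeasurableSet s) (F : Set C(Torus d, ℂ))
    (c : ℂ) (hc : c ≠ 0) (hF : ∀ φ ∈ F, ∫ x in s, φ x = c)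
    (hn : ∀ φ ∈ F, ∀ x, ‖φ x‖ = 1)
    (hκ : ∀ φ ∈ F, ∃ κ : Torus d → ℂ, ∀ a x, φ (a + x) = κ a * φ x) : F.Finite := by
  let v : F → Lp ℂ 2 (volume : Measure (Torus d)) :=
    fun φ => ContinuousMap.toLp (E := ℂ) 2 volume ℂ φ.1
  have hv : Orthonormal ℂ v := by
    classical
    rw [orthonormal_iff_ite]
    rintro ⟨φ, hφ⟩ ⟨ψ, hψ⟩
    simp only [v, ContinuousMap.inner_toLp]
    obtain ⟨κ, hκ1⟩ := hκ φ hφ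
    obtain ⟨η, hη1⟩ := hκ ψ hψ
    split_ifs with heq
    · obtain rfl : φ = ψ := by simpa using heq
      have : ∀ x, φ x * (starRingEnd ℂ) (φ x) = 1 := fun x => by
        rw [Complex.mul_conj', hn φ hφ x]; simp
      simp [this]
    · by_cases hall : ∀ a, η a * (starRingEnd ℂ) (κ a) = 1
      · exfalso
        apply heq
        have hnn : ∀ x, φ x * (starRingEnd ℂ) (φ x) = 1 := fun x => by
          rw [Complex.mul_conj', hn φ hφ x]; simp
        have hk : ∀ x, ψ x = (ψ 0 * (starRingEnd ℂ) (φ 0)) * φ x := by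
          intro x
          have e1 := hη1 x 0
          have e2 := hκ1 x 0
          rw [add_zero] at e1 e2
          have : ψ x * (starRingEnd ℂ) (φ x) = ψ 0 * (starRingEnd ℂ) (φ 0) := by
            rw [e1, e2, map_mul]
            linear_combination (ψ 0 * (starRingEnd ℂ) (φ 0)) * hall x
          linear_combination φ x * this - ψ x * hnn x
        have hone : ψ 0 * (starRingEnd ℂ) (φ 0) = 1 := by
          have e := hF ψ hψ
          rw [integral_congr_ae (Filter.Eventually.of_forall hk)] at e
          rw [integral_const_mul, hF φ hφ] at e
          apply mul_right_cancel₀ hc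
          rw [one_mul]
          exact e
        ext x
        rw [hk x, hone, one_mul]
      · push Not at hall
        obtain ⟨a, ha⟩ := hall
        refine aux_int_zero _ (fun a => η a * (starRingEnd ℂ) (κ a)) (fun a x => ?_) a ha
        rw [hη1, hκ1, map_mul]; ring
  have hsum := hv.inner_products_summable
    (x := indicatorConstLp 2 hs (measure_ne_top volume s) (1 : ℂ))
  have hval : ∀ φ : F, ‖inner ℂ (v φ) (indicatorConstLp 2 hs (measure_ne_top volume s) (1 : ℂ))‖ ^ 2
      = ‖c‖ ^ 2 := by
    intro φ
    rw [norm_inner_symm, L2.inner_indicatorConstLp_one, ← hF φ.1 φ.2]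
    congr 2
    exact integral_congr_ae (ae_restrict_of_ae (ContinuousMap.coeFn_toLp volume _))
  simp_rw [hval] at hsum
  by_contra hinf
  have : Infinite F := Set.infinite_coe_iff.mpr hinf
  rw [summable_const_iff] at hsum
  exact hc (by simpa using hsum)

lemma aux_const {d : ℕ} {Γ : Type*} [Group Γ] (A : Γ → C(Torus d, Torus d))
    (hA : ∀ γ γ' x, A (γ * γ') x = A γ (A γ' x))
    (herg : ∀ s : Set (Torus d), MeasurableSet s → (∀ γ : Γ, A γ ⁻¹' s = s) →
      volume s = 0 ∨ volume s = 1)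
    (χ : C(Torus d, ℂ)) (hA1 : ∀ x, A 1 x = x)
    (hfin : (Set.range fun γ => χ.comp (A γ)).Finite) (x : Torus d) : χ x = χ 0 := by
  classical
  set S := Set.range fun γ => χ.comp (A γ) with hS
  let G : ℂ → Torus d → ℝ := fun z x => ∏ φ ∈ hfin.toFinset, ‖z - φ x‖
  have hGc : ∀ z, Continuous (G z) := fun z => by
    simp only [G]; fun_prop
  have hGi : ∀ z γ x, G z (A γ x) = G z x := by
    intro z γ x
    refine Finset.prod_bij' (fun φ _ => φ.comp (A γ)) (fun φ _ => φ.comp (A γ⁻¹)) ?_ ?_ ?_ ?_ ?_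
    · intro φ hφ
      obtain ⟨δ, rfl⟩ := (hfin.mem_toFinset).mp hφ
      exact hfin.mem_toFinset.mpr ⟨δ * γ, by ext y; simp [hA]⟩
    · intro φ hφ
      obtain ⟨δ, rfl⟩ := (hfin.mem_toFinset).mp hφ
      exact hfin.mem_toFinset.mpr ⟨δ * γ⁻¹, by ext y; simp [hA]⟩
    · intro φ _; ext y; simp [← hA, hA1]
    · intro φ _; ext y; simp [← hA, hA1]
    · intro φ _; rfl
  have hlt : ∀ z a b, ¬ G z a < G z b := by
    intro z a b hab
    obtain ⟨m, h1, h2⟩ := exists_between hab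
    have o1 : IsOpen (G z ⁻¹' Set.Iio m) := isOpen_Iio.preimage (hGc z)
    have o2 : IsOpen (G z ⁻¹' Set.Ioi m) := isOpen_Ioi.preimage (hGc z)
    have p1 : volume (G z ⁻¹' Set.Iio m) ≠ 0 := (o1.measure_pos volume ⟨a, h1⟩).ne'
    have p2 : volume (G z ⁻¹' Set.Ioi m) ≠ 0 := (o2.measure_pos volume ⟨b, h2⟩).ne'
    have q1 := (herg _ o1.measurableSet fun γ => by
      ext y; simp [hGi]).resolve_left p1
    apply p2
    refine measure_mono_null ?_ ((prob_compl_eq_zero_iff o1.measurableSet).mpr q1)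
    intro y hy hy'
    exact lt_asymm (show m < G z y from hy) (show G z y < m from hy')
  have hr : (Set.range χ).Finite := by
    refine (hfin.image fun φ => φ 0).subset ?_
    rintro _ ⟨y, rfl⟩
    have h0 : G (χ y) y = 0 := Finset.prod_eq_zero (i := χ)
      (hfin.mem_toFinset.mpr ⟨1, by ext y; simp [hA1]⟩) (by simp)
    have h1 : G (χ y) 0 = 0 := by
      rw [← h0]; exact le_antisymm (not_lt.mp (hlt _ _ _)) (not_lt.mp (hlt _ _ _))
    obtain ⟨φ, hφ, h2⟩ := Finset.prod_eq_zero_iff.mp h1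
    exact ⟨φ, hfin.mem_toFinset.mp hφ, (sub_eq_zero.mp (norm_eq_zero.mp h2)).symm⟩
  have hsub : (Set.range χ).Subsingleton :=
    hr.countable.isTotallyDisconnected _ subset_rfl (isPreconnected_range χ.continuous)
  exact hsub ⟨x, rfl⟩ ⟨0, rfl⟩

/-- If a group `Γ` of affine transformations of `𝕋^d` acts ergodically
for the Haar (Lebesgue) measure, then so does every finite-index subgroup `Γ₀ ≤ Γ`. -/
theorem stmt6 {d : ℕ} {Γ : Type*} [Group Γ]
    (α : Γ → Torus d) (τ : Γ → Matrix (Fin d) (Fin d) ℤ)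
    (hτ : ∀ γ, IsUnit (τ γ).det)
    (hact : ∀ γ γ' : Γ, ∀ x : Torus d,
      affAct (α (γ * γ')) (τ (γ * γ')) x = affAct (α γ) (τ γ) (affAct (α γ') (τ γ') x))
    (hid : ∀ x : Torus d, affAct (α 1) (τ 1) x = x)
    (herg : ∀ s : Set (Torus d), MeasurableSet s →
      (∀ γ : Γ, (fun x => affAct (α γ) (τ γ) x) ⁻¹' s = s) →
      volume s = 0 ∨ volume s = 1)
    (Γ₀ : Subgroup Γ) (hfin : Γ₀.index ≠ 0) :
    ∀ s : Set (Torus d), MeasurableSet s →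
      (∀ γ ∈ Γ₀, (fun x => affAct (α γ) (τ γ) x) ⁻¹' s = s) →
      volume s = 0 ∨ volume s = 1 := by
  intro s hs hinv
  apply aux_complete s hs
  intro n
  by_contra hcon
  push Not at hcon
  obtain ⟨hc, a, ha⟩ := hcon
  apply ha
  have hsurj : ∀ γ, Function.Surjective (affAct (α γ) (τ γ)) := fun γ y =>
    ⟨affAct (α γ⁻¹) (τ γ⁻¹) y, by rw [← hact, mul_inv_cancel, hid]⟩
  let A : Γ → C(Torus d, Torus d) := fun γ => ⟨affAct (α γ) (τ γ), aff_cont _ _⟩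
  let χ : C(Torus d, ℂ) := UnitAddTorus.mFourier n
  have hadd : ∀ x y, χ (x + y) = χ x * χ y := aux_mFourier_add n
  have h0 : χ 0 = 1 := by
    have h1 := hadd 0 0
    have h2 : χ 0 ≠ 0 := fun h => by
      have := aux_mFourier_norm n 0
      change ‖χ 0‖ = 1 at this
      rw [h] at this; simp at this
    rw [add_zero] at h1
    exact (mul_left_cancel₀ h2 (by rw [mul_one]; exact h1)).symm
  have hF : ((fun γ => χ.comp (A γ)) '' (Γ₀ : Set Γ)).Finite := by
    refine aux_bessel s hs _ _ hc ?_ ?_ ?_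
    · rintro _ ⟨γ, hγ, rfl⟩
      have hmp := aff_mp _ _ (hsurj γ)
      have := setIntegral_map (μ := volume) (g := affAct (α γ) (τ γ)) (f := χ) hs
        χ.continuous.aestronglyMeasurable hmp.measurable.aemeasurable
      rw [hmp.map_eq] at this
      have h3 : affAct (α γ) (τ γ) ⁻¹' s = s := hinv γ hγ
      rw [h3] at this
      exact this.symm
    · rintro _ ⟨γ, hγ, rfl⟩ x
      exact aux_mFourier_norm n _
    · rintro _ ⟨γ, hγ, rfl⟩
      refine ⟨fun a => χ (linPart (τ γ) a), fun a x => ?_⟩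
      change χ (affAct _ _ _) = _ * χ (affAct _ _ _)
      rw [aff_eq, aff_eq, (linPart (τ γ)).map_add, ← hadd]
      congr 1
      abel
  have : Γ₀.FiniteIndex := ⟨hfin⟩
  have hAll : (Set.range fun γ => χ.comp (A γ)).Finite := by
    refine (Set.Finite.image2 (fun φ (q : Γ ⧸ Γ₀) => φ.comp (A (q.out)⁻¹)) hF
      (Set.finite_univ)).subset ?_
    rintro _ ⟨γ, rfl⟩
    obtain ⟨h, hh⟩ := QuotientGroup.mk_out_eq_mul Γ₀ γ⁻¹
    refine ⟨_, ⟨h, h.2, rfl⟩, (γ⁻¹ : Γ), Set.mem_univ _, ?_⟩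
    ext x
    change χ (affAct _ _ (affAct _ _ x)) = χ (affAct _ _ x)
    rw [← hact, hh]
    congr 2 <;> simp
  have := aux_const A hact herg χ hid hAll a
  rw [h0] at this
  exact this
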